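/- arXiv:2401.03489 — 2 statements merged into one kernel-verified Lean document; each statement's English description precedes it below -/
import Mathlib

section
/- Let J : ℝ^d → ℝ be differentiable everywhere with L-Lipschitz gradient for some L > 0. Let η > 0, let θ, v ∈ ℝ^d, and set θ' = θ + η·v. Then J(θ') ≥ J(θ) + (η/2)·‖∇J(θ)‖² + (1/(2η) − L/2)·‖θ' − θ‖² − (η/2)·‖v − ∇J(θ)‖². -/
theorem byzpg_appl_smoothness {d : ℕ} (J : EuclideanSpace ℝ (Fin d) → ℝ) (L : ℝ) (hL : 0 < L)
    (hdiff : Differentiable ℝ J)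
    (hlip : ∀ x y, ‖gradient J x - gradient J y‖ ≤ L * ‖x - y‖)
    (η : ℝ) (hη : 0 < η) (θ v : EuclideanSpace ℝ (Fin d)) :
    J θ + (η / 2) * ‖gradient J θ‖ ^ 2 + (1 / (2 * η) - L / 2) * ‖(θ + η • v) - θ‖ ^ 2
      - (η / 2) * ‖v - gradient J θ‖ ^ 2 ≤ J (θ + η • v) := by
  set g := gradient J θ with hg
  have hder : ∀ t : ℝ, HasDerivAt
      (fun t : ℝ => J (θ + t • v) - t * inner ℝ g v + (L / 2 * ‖v‖ ^ 2) * t ^ 2)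
      (inner ℝ (gradient J (θ + t • v)) v - inner ℝ g v + (L * ‖v‖ ^ 2) * t) t := by
    intro t
    have h1 : HasDerivAt (fun t : ℝ => θ + t • v) v t := by
      simpa using ((hasDerivAt_id t).smul_const v).const_add θ
    have h2 : HasDerivAt (fun t : ℝ => J (θ + t • v))
        (inner ℝ (gradient J (θ + t • v)) v) t := by
      have h := (hdiff (θ + t • v)).hasGradientAt.hasFDerivAt.comp_hasDerivAt t h1
      exact h
    have h3 : HasDerivAt (fun t : ℝ => t * inner ℝ g v) (inner ℝ g v) t := by
      simpa using (hasDerivAt_id t).mul_const (inner ℝ g v)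
    have h4 : HasDerivAt (fun t : ℝ => (L / 2 * ‖v‖ ^ 2) * t ^ 2) ((L * ‖v‖ ^ 2) * t) t := by
      have h := (hasDerivAt_pow 2 t).const_mul (L / 2 * ‖v‖ ^ 2)
      have e : L / 2 * ‖v‖ ^ 2 * (((2 : ℕ) : ℝ) * t ^ (2 - 1)) = (L * ‖v‖ ^ 2) * t := by
        norm_num
        ring
      exact e ▸ h
    exact (h2.sub h3).add h4
  have hmono := monotoneOn_of_deriv_nonneg (convex_Icc 0 η)
    (fun t _ => (hder t).continuousAt.continuousWithinAt)
    (fun t _ => (hder t).differentiableAt.differentiableWithinAt)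
    (by
      intro t ht
      rw [interior_Icc] at ht
      rw [(hder t).deriv, ← inner_sub_left]
      have h1 := neg_le_of_abs_le (abs_real_inner_le_norm (gradient J (θ + t • v) - g) v)
      have h2 : ‖gradient J (θ + t • v) - g‖ ≤ L * (t * ‖v‖) := by
        have := hlip (θ + t • v) θ
        rwa [add_sub_cancel_left, norm_smul, Real.norm_of_nonneg ht.1.le] at this
      have h3 := mul_le_mul_of_nonneg_right h2 (norm_nonneg v)
      nlinarith)
  have key := hmono (Set.left_mem_Icc.2 hη.le) (Set.right_mem_Icc.2 hη.le) hη.le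
  simp only [zero_smul, add_zero, zero_mul, sub_zero] at key
  rw [add_sub_cancel_left, norm_smul, Real.norm_of_nonneg hη.le, norm_sub_sq_real,
    real_inner_comm]
  have e : (1 / (2 * η) - L / 2) * (η * ‖v‖) ^ 2 = η / 2 * ‖v‖ ^ 2 - L / 2 * ‖v‖ ^ 2 * η ^ 2 := by
    field_simp
  rw [e]
  nlinarith
end

section
/- Let J : ℝ^d → ℝ be differentiable everywhere with L-Lipschitz gradient for some L > 0. Let G be a finite nonempty index set, let (θ^(i))_{i ∈ G} be vectors in ℝ^d, let θ̄ = (1/|G|) ∑_{i ∈ G} θ^(i) be their average, and let D = max_{i, l ∈ G} ‖θ^(i) − θ^(l)‖ be their diameter. Let η > 0, let v̄ ∈ ℝ^d, and set θ̄' = θ̄ + η·v̄. Then J(θ̄') ≥ J(θ̄) + (η/2)·‖∇J(θ̄)‖² + (1/(2η) − L/2)·‖θ̄' − θ̄‖² − η·‖v̄ − (1/|G|) ∑_{i ∈ G} ∇J(θ^(i))‖² − η·L²·D². -/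
theorem avg_sub_norm_le {E ι : Type*} [NormedAddCommGroup E] [NormedSpace ℝ E]
    (G : Finset ι) (hG : G.Nonempty) (f : ι → E) (a : E) (R : ℝ)
    (h : ∀ i ∈ G, ‖f i - a‖ ≤ R) : ‖(G.card : ℝ)⁻¹ • ∑ i ∈ G, f i - a‖ ≤ R := by
  have hc : (G.card : ℝ) ≠ 0 := by exact_mod_cast hG.card_pos.ne'
  have hm : ∑ i ∈ G, (G.card : ℝ)⁻¹ • f i ∈ Metric.closedBall a R := by
    apply (convex_closedBall a R).sum_mem
    · intro i _; positivity
    · simp [hc]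
    · intro i hi
      rw [mem_closedBall_iff_norm]; exact h i hi
  rw [mem_closedBall_iff_norm, ← Finset.smul_sum] at hm
  exact hm

theorem ascent_aux {E : Type*} [NormedAddCommGroup E] [InnerProductSpace ℝ E] [CompleteSpace E]
    (J : E → ℝ) (L : ℝ) (hdiff : Differentiable ℝ J)
    (hlip : ∀ x y, ‖gradient J x - gradient J y‖ ≤ L * ‖x - y‖) (x w : E) :
    J x + inner ℝ (gradient J x) w - L / 2 * ‖w‖ ^ 2 ≤ J (x + w) := by
  have hd : ∀ t : ℝ, HasDerivAt
      (fun t : ℝ => J (x + t • w) - t * inner ℝ (gradient J x) w + L / 2 * ‖w‖ ^ 2 * t ^ 2)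
      (inner ℝ (gradient J (x + t • w)) w - inner ℝ (gradient J x) w + L * ‖w‖ ^ 2 * t) t := by
    intro t
    have h1 : HasDerivAt (fun t : ℝ => x + t • w) w t := by
      simpa using ((hasDerivAt_id t).smul_const w).const_add x
    have h2 := (hdiff (x + t • w)).hasGradientAt.hasFDerivAt.comp_hasDerivAt t h1
    have h3 := (hasDerivAt_id t).mul_const (inner ℝ (gradient J x) w)
    have h4 := ((hasDerivAt_id t).pow 2).const_mul (L / 2 * ‖w‖ ^ 2)
    refine ((h2.sub h3).add h4).congr_deriv ?_
    simp
    ring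
  have hm : MonotoneOn
      (fun t : ℝ => J (x + t • w) - t * inner ℝ (gradient J x) w + L / 2 * ‖w‖ ^ 2 * t ^ 2)
      (Set.Icc 0 1) := by
    apply monotoneOn_of_deriv_nonneg (convex_Icc 0 1)
    · exact fun t _ => (hd t).continuousAt.continuousWithinAt
    · exact fun t _ => (hd t).differentiableAt.differentiableWithinAt
    · intro t ht
      rw [interior_Icc] at ht
      rw [(hd t).deriv, ← inner_sub_left]
      have h1 := abs_le.1 (abs_real_inner_le_norm (gradient J (x + t • w) - gradient J x) w)
      have h2 := hlip (x + t • w) x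
      rw [add_sub_cancel_left, norm_smul, Real.norm_of_nonneg ht.1.le] at h2
      have h3 := mul_le_mul_of_nonneg_right h2 (norm_nonneg w)
      nlinarith [h1.1]
  have := hm (Set.left_mem_Icc.2 zero_le_one) (Set.right_mem_Icc.2 zero_le_one) zero_le_one
  simp only [zero_smul, one_smul, add_zero] at this
  linarith

theorem decbyzpg_appl_smoothness {d : ℕ} {ι : Type*}
    (J : EuclideanSpace ℝ (Fin d) → ℝ) (L : ℝ) (hL : 0 < L)
    (hdiff : Differentiable ℝ J)
    (hlip : ∀ x y, ‖gradient J x - gradient J y‖ ≤ L * ‖x - y‖)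
    (G : Finset ι) (hG : G.Nonempty) (θ : ι → EuclideanSpace ℝ (Fin d))
    (η : ℝ) (hη : 0 < η) (v : EuclideanSpace ℝ (Fin d))
    (θbar : EuclideanSpace ℝ (Fin d)) (hθbar : θbar = (G.card : ℝ)⁻¹ • ∑ i ∈ G, θ i)
    (D : ℝ) (hD : D = (G ×ˢ G).sup' (hG.product hG) (fun q => ‖θ q.1 - θ q.2‖)) :
    J θbar + (η / 2) * ‖gradient J θbar‖ ^ 2
      + (1 / (2 * η) - L / 2) * ‖(θbar + η • v) - θbar‖ ^ 2
      - η * ‖v - (G.card : ℝ)⁻¹ • ∑ i ∈ G, gradient J (θ i)‖ ^ 2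
      - η * L ^ 2 * D ^ 2 ≤ J (θbar + η • v) := by
  have hDle : ∀ i ∈ G, ∀ l ∈ G, ‖θ i - θ l‖ ≤ D := by
    intro i hi l hl
    rw [hD]
    exact Finset.le_sup' (fun q : ι × ι => ‖θ q.1 - θ q.2‖) (Finset.mk_mem_product hi hl)
  have h1 : ∀ i ∈ G, ‖θ i - θbar‖ ≤ D := by
    intro i hi
    rw [norm_sub_rev, hθbar]
    exact avg_sub_norm_le G hG θ (θ i) D fun l hl => hDle l hl i hi
  have h2 := avg_sub_norm_le G hG (fun i => gradient J (θ i)) (gradient J θbar) (L * D)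
    fun i hi => (hlip _ _).trans (mul_le_mul_of_nonneg_left (h1 i hi) hL.le)
  have h3 := ascent_aux J L hdiff hlip θbar (η • v)
  set m := (G.card : ℝ)⁻¹ • ∑ i ∈ G, gradient J (θ i) with hm
  set g := gradient J θbar with hg
  have h4 : ‖v - g‖ ^ 2 ≤ 2 * ‖v - m‖ ^ 2 + 2 * (L * D) ^ 2 := by
    have ha : ‖v - g‖ ≤ ‖v - m‖ + ‖m - g‖ := norm_sub_le_norm_sub_add_norm_sub v m g
    have hb : ‖v - g‖ ≤ ‖v - m‖ + L * D := by linarith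
    have hc := pow_le_pow_left₀ (norm_nonneg _) hb 2
    nlinarith [sq_nonneg (‖v - m‖ - L * D)]
  have h5 := norm_sub_sq_real v g
  rw [real_inner_comm] at h5
  rw [inner_smul_right, norm_smul, Real.norm_of_nonneg hη.le] at h3
  rw [add_sub_cancel_left, norm_smul, Real.norm_of_nonneg hη.le]
  have h6 : (1 / (2 * η) - L / 2) * (η * ‖v‖) ^ 2
      = η / 2 * ‖v‖ ^ 2 - L / 2 * (η * ‖v‖) ^ 2 := by
    field_simp
  have h7 := mul_le_mul_of_nonneg_left h4 hη.le
  rw [h5] at h7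
  rw [h6]
  nlinarith
end
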